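/- Let p be a prime, n ≥ 1, let k be a field of characteristic 0, and let K/k be a finite abelian Galois extension such that K contains a primitive pⁿ-th root of unity. (a) If (k, pⁿ) is not the special case, then there exists an element of kˣ that is a pⁿ-th power in K but not in k if and only if k contains a primitive p-th root of unity and p divides the degree [K : k(μ_{pⁿ})]. (b) If p = 2 and (k, 2ⁿ) is the special case, then there exists an element of kˣ that is a 2ⁿ-th power in K but not in k. -/

import Mathlib

/-- The field `k(μ_m)` obtained by adjoining all `m`-th roots of unity, realised inside an
algebraic closure of `k`. -/
noncomputable def cycloExt (k : Type*) [Field k] (m : ℕ) :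
    IntermediateField k (AlgebraicClosure k) :=
  IntermediateField.adjoin k {x : AlgebraicClosure k | x ^ m = 1}

/-- `(k, pⁿ)` is the *special case*: `p = 2`, `n ≥ 2`, and there is a `k`-automorphism of
`k(μ_{2ⁿ})` inverting all `2ⁿ`-th roots of unity (equivalently, `k ∩ ℚ(μ_{2ⁿ})` is totally
real). -/
def IsSpecialCase (k : Type*) [Field k] (p n : ℕ) : Prop :=
  p = 2 ∧ 2 ≤ n ∧
    ∃ σ : cycloExt k (2 ^ n) ≃ₐ[k] cycloExt k (2 ^ n),
      ∀ ζ : cycloExt k (2 ^ n), ζ ^ 2 ^ n = 1 → σ ζ = ζ⁻¹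

/-- The natural map `kˣ/kˣ^m → Kˣ/Kˣ^m` induced by the inclusion `k ⊆ K`. -/
noncomputable def powQuotMap (k K : Type*) [Field k] [Field K] [Algebra k K] (m : ℕ) :
    kˣ ⧸ (powMonoidHom m : kˣ →* kˣ).range →* Kˣ ⧸ (powMonoidHom m : Kˣ →* Kˣ).range :=
  QuotientGroup.lift _
    ((QuotientGroup.mk' _).comp (Units.map (algebraMap k K : k →+* K).toMonoidHom))
    (by
      rintro x ⟨y, rfl⟩
      rw [MonoidHom.mem_ker, MonoidHom.comp_apply, QuotientGroup.mk'_apply,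
        QuotientGroup.eq_one_iff]
      exact ⟨Units.map (algebraMap k K : k →+* K).toMonoidHom y, by
        simp [powMonoidHom_apply, map_pow]⟩)

/-- The kernel of `kˣ/kˣ^m → Kˣ/Kˣ^m`; by inflation–restriction and Hilbert 90 this is
`H¹(K/k, μ_m(K))` when `K/k` is Galois with `μ_m ⊆ K`. -/
noncomputable def powQuotKernel (k K : Type*) [Field k] [Field K] [Algebra k K] (m : ℕ) :
    Subgroup (kˣ ⧸ (powMonoidHom m : kˣ →* kˣ).range) :=
  (powQuotMap k K m).ker




theorem aux_cyc (p n : ℕ) (hp : p.Prime) (S : Subgroup (ZMod (p ^ n))ˣ)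
    (hS : p = 2 → 2 ≤ n → (-1 : (ZMod (p ^ n))ˣ) ∉ S) : IsCyclic S := by
  by_cases h2 : p = 2
  · subst h2
    by_cases hn : n ≤ 2
    · have := (ZMod.isCyclic_units_two_pow_iff n).2 hn
      infer_instance
    obtain ⟨m, rfl⟩ : ∃ m, n = m + 2 := ⟨n - 2, by omega⟩
    have hm1 := hS rfl (by omega)
    let C : Subgroup (ZMod (2 ^ (m + 2)))ˣ := Subgroup.zpowers (-1)
    have hC : ∀ x ∈ C, x = 1 ∨ x = -1 := by
      intro x hx
      obtain ⟨i, rfl⟩ := hx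
      rcases Int.even_or_odd i with h | h
      · left; exact h.neg_one_zpow
      · right; exact h.neg_one_zpow
    -- the unit 5
    have h5u : IsUnit (5 : ZMod (2 ^ (m + 2))) := by
      have : Nat.Coprime 5 (2 ^ (m + 2)) := Nat.Coprime.pow_right _ (by norm_num)
      simpa using (ZMod.unitOfCoprime 5 this).isUnit
    obtain ⟨f, hf⟩ := h5u
    have hford : orderOf f = 2 ^ m := by
      rw [← orderOf_units, hf, ZMod.orderOf_five]
    have hm1f : ∀ i : ℕ, f ^ i ≠ -1 := by
      intro i hi
      have h1 := congrArg (fun x : (ZMod (2 ^ (m + 2)))ˣ => ZMod.castHom (show 4 ∣ 2 ^ (m + 2) from ⟨2 ^ m, by ring⟩) (ZMod 4) (x : ZMod (2 ^ (m + 2)))) hi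
      simp only [Units.val_pow_eq_pow_val, hf, map_pow, Units.val_neg, Units.val_one, map_neg, map_one, map_ofNat] at h1
      rw [show (5 : ZMod 4) = 1 by decide, one_pow] at h1
      exact absurd h1 (by decide)
    let Q := (ZMod (2 ^ (m + 2)))ˣ ⧸ C
    have hcardC : Nat.card C = 2 := by
      rw [Nat.card_zpowers]
      have : (-1 : (ZMod (2 ^ (m + 2)))ˣ) ≠ 1 := fun h => hm1 (by rw [h]; exact S.one_mem)
      exact orderOf_eq_prime (by simp) this
    have hcardQ : Nat.card Q = 2 ^ m := by
      have h1 := C.card_eq_card_quotient_mul_card_subgroup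
      rw [hcardC, Nat.card_eq_fintype_card, ZMod.card_units_eq_totient,
        Nat.totient_prime_pow_succ Nat.prime_two] at h1
      have : 2 ^ (m + 1) * (2 - 1) = 2 ^ m * 2 := by ring
      rw [this] at h1
      exact (Nat.eq_of_mul_eq_mul_right (by norm_num) h1).symm
    have hQ : IsCyclic Q := by
      refine isCyclic_of_orderOf_eq_card (QuotientGroup.mk f : Q) ?_
      rw [hcardQ, ← hford]
      apply Nat.dvd_antisymm
      · exact orderOf_map_dvd (QuotientGroup.mk' C) f
      · rw [orderOf_dvd_iff_pow_eq_one]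
        have h1 : (QuotientGroup.mk f : Q) ^ orderOf (QuotientGroup.mk f : Q) = 1 := pow_orderOf_eq_one _
        rw [← QuotientGroup.mk_pow, QuotientGroup.eq_one_iff] at h1
        rcases hC _ h1 with h | h
        · exact h
        · exact absurd h (hm1f _)
    refine isCyclic_of_injective ((QuotientGroup.mk' C).comp S.subtype) ?_
    rw [injective_iff_map_eq_one]
    intro a ha
    simp only [MonoidHom.comp_apply, Subgroup.coe_subtype, QuotientGroup.mk'_apply, QuotientGroup.eq_one_iff] at ha
    rcases hC _ ha with h | h
    · exact Subtype.ext h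
    · exact absurd (h ▸ a.2) hm1
  · have := ZMod.isCyclic_units_of_prime_pow p hp h2 n
    infer_instance

theorem aux_val (p n U : ℕ) (hp : p.Prime) (hn : 1 ≤ n) (hU1 : 1 < U) (hpU : p ∣ U - 1)
    (u : (ZMod (p ^ n))ˣ) (hu : (U : ZMod (p ^ n)) = u) (hne : u ≠ 1)
    (hs : p = 2 → 2 ≤ n → u ≠ -1) :
    padicValNat p (U ^ orderOf u - 1) = n := by
  have := Fact.mk hp
  have : NeZero (p ^ n) := ⟨pow_ne_zero _ hp.ne_zero⟩
  have key : ∀ i : ℕ, 0 < i → (u ^ i = 1 ↔ n ≤ padicValNat p (U ^ i - 1)) := by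
    intro i hi
    have h1 : 1 < U ^ i := Nat.one_lt_pow hi.ne' hU1
    rw [← padicValNat_dvd_iff_le (by omega), ← ZMod.natCast_eq_zero_iff,
      Nat.cast_sub h1.le, sub_eq_zero, Units.ext_iff]
    simp [hu]
  have hdvd : orderOf u ∣ p ^ (n - 1) := by
    rw [orderOf_dvd_iff_pow_eq_one, key _ (pow_pos hp.pos _), ← padicValNat_dvd_iff_le]
    · have h1 : (p : ℤ) ∣ (U : ℤ) - 1 := by
        have := Int.natCast_dvd_natCast.2 hpU
        rwa [Nat.cast_sub hU1.le] at this
      have := dvd_sub_pow_of_dvd_sub h1 (n - 1)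
      rw [one_pow, Nat.sub_add_cancel hn] at this
      have h2 : 1 ≤ U ^ p ^ (n - 1) := Nat.one_le_pow _ _ (by omega)
      rw [← Int.natCast_dvd_natCast, Nat.cast_sub h2]
      exact_mod_cast this
    · have := Nat.one_lt_pow (pow_pos hp.pos (n - 1)).ne' hU1
      omega
  obtain ⟨j, -, hj⟩ := (Nat.dvd_prime_pow hp).1 hdvd
  have hj0 : j ≠ 0 := by
    rintro rfl
    exact hne (orderOf_eq_one_iff.1 (by simpa using hj))
  obtain ⟨i, rfl⟩ := Nat.exists_eq_succ_of_ne_zero hj0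
  have hge : n ≤ padicValNat p (U ^ orderOf u - 1) :=
    (key _ (orderOf_pos u)).1 (pow_orderOf_eq_one u)
  have hlt : padicValNat p (U ^ (p ^ i) - 1) < n := by
    by_contra h
    push Not at h
    have := orderOf_dvd_of_pow_eq_one ((key _ (pow_pos hp.pos i)).2 h)
    rw [hj, Nat.pow_dvd_pow_iff_le_right hp.one_lt] at this
    omega
  have hUp : ¬ p ∣ U := by
    intro h
    have := (Nat.dvd_sub h hpU)
    rw [Nat.sub_sub_self hU1.le] at this
    exact hp.one_lt.ne' (Nat.dvd_one.1 this)
  rw [hj] at hge ⊢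
  by_cases h2 : p = 2
  · subst h2
    have e1 := padicValNat.pow_two_sub_pow (x := U) (y := 1) hU1 hpU hUp (n := 2 ^ (i + 1)) (by positivity) (by simp [Nat.even_pow])
    simp only [one_pow, padicValNat.prime_pow] at e1
    by_cases hi : i = 0
    · subst hi
      have hv1 : padicValNat 2 (U - 1) < n := by simpa using hlt
      by_cases hn2 : 2 ≤ n
      · have hv2 : padicValNat 2 (U + 1) < n := by
          by_contra h
          push Not at h
          rw [← padicValNat_dvd_iff_le (by omega), ← ZMod.natCast_eq_zero_iff] at h
          apply hs rfl hn2
          ext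
          push_cast at h
          rw [hu] at h
          simpa using eq_neg_of_add_eq_zero_left h
        have hmin : padicValNat 2 (U - 1) ≤ 1 ∨ padicValNat 2 (U + 1) ≤ 1 := by
          by_contra h
          push Not at h
          have a1 := (padicValNat_dvd_iff_le (p := 2) (a := U - 1) (n := 2) (by omega)).2 h.1
          have a2 := (padicValNat_dvd_iff_le (p := 2) (a := U + 1) (n := 2) (by omega)).2 h.2
          omega
        simp only [zero_add, pow_one] at *
        omega
      · exfalso
        have := (padicValNat_dvd_iff_le (p := 2) (a := U - 1) (n := 1) (by omega)).1 (by simpa using hpU)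
        omega
    · have e2 := padicValNat.pow_two_sub_pow (x := U) (y := 1) hU1 hpU hUp (n := 2 ^ i) (by positivity) (by simp [Nat.even_pow, hi])
      simp only [one_pow, padicValNat.prime_pow] at e2
      simp only [Nat.succ_eq_add_one] at *
      omega
  · have hodd := hp.odd_of_ne_two h2
    have e1 := padicValNat.pow_sub_pow hodd (x := U) (y := 1) hU1 hpU hUp (n := p ^ (i + 1)) (pow_ne_zero _ hp.ne_zero)
    have e2 := padicValNat.pow_sub_pow hodd (x := U) (y := 1) hU1 hpU hUp (n := p ^ i) (pow_ne_zero _ hp.ne_zero)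
    simp only [one_pow, padicValNat.prime_pow] at e1 e2
    simp only [Nat.succ_eq_add_one] at *
    omega

theorem aux_arith (p n : ℕ) (hp : p.Prime) (hn : 1 ≤ n)
    (u : (ZMod (p ^ n))ˣ) (hpU : p ∣ (u : ZMod (p ^ n)).val - 1)
    (hs : p = 2 → 2 ≤ n → u ≠ -1) :
    (∑ i ∈ Finset.range (orderOf u), (u : ZMod (p ^ n)) ^ i) ≠ 0 ∧
    ∀ a : ZMod (p ^ n), (∑ i ∈ Finset.range (orderOf u), (u : ZMod (p ^ n)) ^ i) * a = 0 →
      ∃ b, ((u : ZMod (p ^ n)) - 1) * b = a := by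
  have := Fact.mk hp
  have : NeZero (p ^ n) := ⟨pow_ne_zero _ hp.ne_zero⟩
  have h1q : 1 < p ^ n := Nat.one_lt_pow (by omega) hp.one_lt
  have : Fact (1 < p ^ n) := ⟨h1q⟩
  by_cases hne : u = 1
  · subst hne
    simp
  set U := (u : ZMod (p ^ n)).val with hUdef
  have hU : (U : ZMod (p ^ n)) = u := by simp [U]
  have hU1 : 1 < U := by
    have h0 : U ≠ 0 := by
      intro h
      rw [h] at hU
      exact u.ne_zero (by simpa using hU.symm)
    have h1 : U ≠ 1 := by
      intro h
      rw [h] at hU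
      exact hne (Units.ext (by simpa using hU.symm))
    omega
  have hv := aux_val p n U hp hn hU1 hpU u hU hne hs
  set d := orderOf u with hd
  have hdpos : 0 < d := orderOf_pos u
  have h1 : 1 < U ^ d := Nat.one_lt_pow hdpos.ne' hU1
  obtain ⟨r, hr⟩ : p ^ n ∣ U ^ d - 1 := (padicValNat_dvd_iff_le (by omega)).2 hv.ge
  have hpr : ¬ p ∣ r := by
    rintro ⟨s, rfl⟩
    have : p ^ (n + 1) ∣ U ^ d - 1 := ⟨s, by rw [hr]; ring⟩
    rw [padicValNat_dvd_iff_le (by omega)] at this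
    omega
  set N : ℕ := ∑ i ∈ Finset.range d, U ^ i with hN
  have hNU : N * (U - 1) = p ^ n * r := by
    rw [← hr]
    have := geom_sum_mul_of_one_le hU1.le d
    exact this
  have hcast : (∑ i ∈ Finset.range d, (u : ZMod (p ^ n)) ^ i) = (N : ZMod (p ^ n)) := by
    simp [hN, hU]
  rw [hcast]
  constructor
  · rw [Ne, ZMod.natCast_eq_zero_iff]
    rintro ⟨s, hs'⟩
    obtain ⟨t, ht⟩ := hpU
    rw [hs', ht] at hNU
    apply hpr
    refine ⟨s * t, ?_⟩
    apply Nat.eq_of_mul_eq_mul_left (by omega : 0 < p ^ n)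
    rw [← hNU]; ring
  · intro a ha
    have ha' : ((N * a.val : ℕ) : ZMod (p ^ n)) = 0 := by simpa using ha
    rw [ZMod.natCast_eq_zero_iff] at ha'
    obtain ⟨s, hs'⟩ := ha'
    have h2 : (U - 1) * s = r * a.val := by
      apply Nat.eq_of_mul_eq_mul_left (by omega : 0 < p ^ n)
      calc p ^ n * ((U - 1) * s) = (p ^ n * s) * (U - 1) := by ring
        _ = N * (U - 1) * a.val := by rw [← hs']; ring
        _ = _ := by rw [hNU]; ring
    have hru : IsUnit (r : ZMod (p ^ n)) := by
      rw [ZMod.isUnit_iff_coprime]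
      exact Nat.Coprime.pow_right _ ((Nat.Prime.coprime_iff_not_dvd hp).2 hpr).symm
    obtain ⟨v, hv'⟩ := hru
    have h3 := congrArg (Nat.cast (R := ZMod (p ^ n))) h2
    push_cast [Nat.cast_sub hU1.le] at h3
    rw [hU, ZMod.natCast_zmod_val, ← hv'] at h3
    refine ⟨s * ↑v⁻¹, ?_⟩
    rw [← mul_assoc, h3]
    rw [mul_comm (v : ZMod (p ^ n)), mul_assoc]; simp

theorem cycloExt_normal (k : Type*) [Field k] (m : ℕ) : Normal k (cycloExt k m) := by
  rw [IntermediateField.normal_iff_forall_map_le]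
  intro σ
  rw [cycloExt, IntermediateField.adjoin_map]
  apply IntermediateField.adjoin.mono
  rintro _ ⟨x, hx, rfl⟩
  simp only [Set.mem_ofPred_eq] at hx ⊢
  rw [← map_pow, hx, map_one]

theorem special_iff (k K : Type*) [Field k] [Field K]
    [Algebra k K] [FiniteDimensional k K] [IsGalois k K] (n : ℕ) (hn : 2 ≤ n)
    (ζ : K) (hζ : IsPrimitiveRoot ζ (2 ^ n)) :
    IsSpecialCase k 2 n ↔ ∃ σ : K ≃ₐ[k] K, σ ζ = ζ⁻¹ := by
  let f : K →ₐ[k] AlgebraicClosure k := IsAlgClosed.lift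
  let : Algebra K (AlgebraicClosure k) := f.toRingHom.toAlgebra
  have : IsScalarTower k K (AlgebraicClosure k) := IsScalarTower.of_algebraMap_eq (fun x => (f.commutes x).symm)
  have hfz : (f ζ) ^ 2 ^ n = 1 := by rw [← map_pow, hζ.pow_eq_one, map_one]
  have := cycloExt_normal k (2 ^ n)
  constructor
  · rintro ⟨-, -, σ, hσ⟩
    let τ := σ.liftNormal (AlgebraicClosure k)
    refine ⟨τ.restrictNormal K, ?_⟩
    refine f.injective (?_ : f _ = f _)
    have h1 := τ.restrictNormal_commutes K ζ
    change f _ = τ (f ζ) at h1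
    rw [h1, map_inv₀]
    have hmem : f ζ ∈ cycloExt k (2 ^ n) := IntermediateField.subset_adjoin _ _ hfz
    have h2 := σ.liftNormal_commutes (AlgebraicClosure k) ⟨f ζ, hmem⟩
    rw [hσ ⟨f ζ, hmem⟩ (by ext; simpa using hfz)] at h2
    exact h2
  · rintro ⟨σ, hσ⟩
    refine ⟨rfl, hn, ?_⟩
    let τ := σ.liftNormal (AlgebraicClosure k)
    refine ⟨τ.restrictNormal (cycloExt k (2 ^ n)), ?_⟩
    intro ξ hξ
    have h1 := τ.restrictNormal_commutes (cycloExt k (2 ^ n)) ξ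
    apply (algebraMap (cycloExt k (2 ^ n)) (AlgebraicClosure k)).injective
    rw [h1, map_inv₀]
    have hprim : IsPrimitiveRoot (f ζ) (2 ^ n) := hζ.map_of_injective f.injective
    have hξ' : (algebraMap (cycloExt k (2 ^ n)) (AlgebraicClosure k) ξ) ^ 2 ^ n = 1 := by
      rw [← map_pow, hξ, map_one]
    have : NeZero (2 ^ n) := ⟨by positivity⟩
    obtain ⟨i, -, hi⟩ := hprim.eq_pow_of_pow_eq_one hξ'
    have h2 := σ.liftNormal_commutes (AlgebraicClosure k) ζ
    change τ (f ζ) = f _ at h2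
    rw [← hi, map_pow, h2, hσ, map_inv₀, inv_pow]


theorem part_b (k K : Type*) [Field k] [CharZero k] [Field K]
    [Algebra k K] (n : ℕ) (hn : 2 ≤ n)
    (ζ : K) (hζ : IsPrimitiveRoot ζ (2 ^ n)) (σ : K ≃ₐ[k] K) (hσ : σ ζ = ζ⁻¹) :
    ∃ x : kˣ, (∃ y : K, y ^ 2 ^ n = algebraMap k K (x : k)) ∧
        ¬∃ z : k, z ^ 2 ^ n = (x : k) := by
  classical
  have : CharZero K := charZero_of_injective_algebraMap (algebraMap k K).injective
  have hinv : ∀ ξ : K, ξ ^ 2 ^ n = 1 → σ ξ = ξ⁻¹ := by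
    intro ξ hξ
    have : NeZero (2 ^ n) := ⟨by positivity⟩
    obtain ⟨i, -, hi⟩ := hζ.eq_pow_of_pow_eq_one hξ
    rw [← hi, map_pow, hσ, inv_pow]
  let c : ℕ → K := fun s => ζ ^ 2 ^ (n - s)
  have hcprim : ∀ s ≤ n, IsPrimitiveRoot (c s) (2 ^ s) := by
    intro s hs
    refine hζ.pow (by positivity) ?_
    rw [← pow_add, Nat.sub_add_cancel hs]
  let P : ℕ → Prop := fun s => 2 ≤ s ∧ ∃ e : k, algebraMap k K e = c s + (c s)⁻¹
  have hP2 : P 2 := by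
    refine ⟨le_rfl, 0, ?_⟩
    have h := hcprim 2 hn
    have h2 : IsPrimitiveRoot (c 2 ^ 2) 2 := h.pow (by norm_num) (by norm_num)
    have h3 := h2.eq_neg_one_of_two_right
    have h0 : c 2 ≠ 0 := h.ne_zero (by norm_num)
    rw [map_zero]
    field_simp
    rw [h3]; ring
  set s := Nat.findGreatest P n with hs
  obtain ⟨hs2, e, he⟩ : P s := Nat.findGreatest_spec hn hP2
  have hsn : s ≤ n := Nat.findGreatest_le n
  have hξ := hcprim s hsn
  set ξ := c s with hξdef
  have hξ0 : ξ ≠ 0 := hξ.ne_zero (by positivity)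
  have hξn : ξ ^ 2 ^ n = 1 := by
    rw [← Nat.add_sub_of_le hsn, pow_add, pow_mul, hξ.pow_eq_one, one_pow]
  have hξ1 : 1 + ξ ≠ 0 := by
    intro h
    have h1 : ξ ^ 2 = 1 := by
      have : ξ = -1 := by linear_combination h
      rw [this]; norm_num
    have h2 := Nat.le_of_dvd (by norm_num) (hξ.dvd_of_pow_eq_one _ h1)
    have h3 : 2 ^ 2 ≤ 2 ^ s := Nat.pow_le_pow_right (by norm_num) hs2
    omega
  have hsq : (1 + ξ) ^ 2 = ξ * (2 + algebraMap k K e) := by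
    rw [he]; field_simp; ring
  obtain ⟨m, rfl⟩ : ∃ m, n = m + 1 := ⟨n - 1, by omega⟩
  have hsgn : ∃ t : k, algebraMap k K t = ξ ^ 2 ^ m := by
    have : (ξ ^ 2 ^ m) ^ 2 = 1 := by rw [← pow_mul, ← pow_succ, hξn]
    rcases sq_eq_one_iff.1 this with h | h
    · exact ⟨1, by rw [h, map_one]⟩
    · exact ⟨-1, by rw [h, map_neg, map_one]⟩
  obtain ⟨t, ht⟩ := hsgn
  have hx : algebraMap k K (t * (2 + e) ^ 2 ^ m) = (1 + ξ) ^ 2 ^ (m + 1) := by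
    rw [pow_succ', pow_mul, hsq, mul_pow, map_mul, ht, map_pow, map_add, map_ofNat]
  have hx0 : t * (2 + e) ^ 2 ^ m ≠ 0 := by
    intro h
    rw [h, map_zero] at hx
    exact pow_ne_zero _ hξ1 hx.symm
  refine ⟨Units.mk0 _ hx0, ⟨1 + ξ, hx.symm⟩, ?_⟩
  rintro ⟨z, hz⟩
  rw [Units.val_mk0] at hz
  have hz' : (algebraMap k K z) ^ 2 ^ (m + 1) = (1 + ξ) ^ 2 ^ (m + 1) := by
    rw [← map_pow, hz, hx]
  set w : K := algebraMap k K z / (1 + ξ) with hw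
  have hwn : w ^ 2 ^ (m + 1) = 1 := by
    rw [hw, div_pow, hz', div_self (pow_ne_zero _ hξ1)]
  have hw0 : w ≠ 0 := by
    intro h; rw [h, zero_pow (by positivity)] at hwn; exact zero_ne_one hwn
  have hzw : algebraMap k K z = w * (1 + ξ) := by rw [hw]; field_simp
  have hsz : w⁻¹ * (1 + ξ⁻¹) = w * (1 + ξ) := by
    have := σ.commutes z
    rw [hzw, map_mul, map_add, map_one, hinv w hwn, hinv ξ hξn] at this
    exact this
  have hw2 : w ^ 2 * ξ = 1 := by
    field_simp at hsz
    have h1 : (1 + ξ) * (w ^ 2 * ξ - 1) = 0 := by linear_combination -hsz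
    rcases mul_eq_zero.1 h1 with h | h
    · exact absurd h hξ1
    · linear_combination h
  by_cases hlt : s = m + 1
  · have h1 : ξ ^ 2 ^ m = 1 := by
      have h2 : (w ^ 2 * ξ) ^ 2 ^ m = 1 := by rw [hw2, one_pow]
      rwa [mul_pow, ← pow_mul, ← pow_succ', hwn, one_mul] at h2
    have h3 := hξ.dvd_of_pow_eq_one _ h1
    rw [hlt, Nat.pow_dvd_pow_iff_le_right (by norm_num)] at h3
    omega
  · have hlt' : s + 1 ≤ m + 1 := by omega
    have hnot : ¬ P (s + 1) := Nat.findGreatest_is_greatest (Nat.lt_succ_self _) hlt'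
    apply hnot
    have hcc : c (s + 1) ^ 2 = ξ := by
      simp only [c, hξdef]
      rw [← pow_mul, ← pow_succ]
      congr 2
      omega
    have hc0 : c (s + 1) ≠ 0 := (hcprim _ hlt').ne_zero (by positivity)
    have hprod : (w * c (s + 1)) ^ 2 = 1 := by rw [mul_pow, hcc, hw2]
    refine ⟨by omega, ?_⟩
    rcases sq_eq_one_iff.1 hprod with h | h
    · refine ⟨z, ?_⟩
      have : (c (s + 1))⁻¹ = w := by field_simp; linear_combination -h
      rw [hzw, this, ← hcc]
      linear_combination (c (s + 1)) * h
    · refine ⟨-z, ?_⟩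
      have : (c (s + 1))⁻¹ = -w := by field_simp; linear_combination h
      rw [map_neg, hzw, this, ← hcc]
      linear_combination -(c (s + 1)) * h


theorem char_exists_comm (H F : Type*) [CommGroup H] [Finite H] [Field F] (p : ℕ) (hp : p.Prime)
    (ω : F) (hω : IsPrimitiveRoot ω p) (hc : p ∣ Nat.card H) :
    ∃ φ : H →* Fˣ, (∃ h, φ h ≠ 1) ∧ ∀ h, φ h ^ p = 1 := by
  have := Fact.mk hp
  have : NeZero p := ⟨hp.ne_zero⟩
  let R : Subgroup H := (powMonoidHom p : H →* H).range
  have hR : R ≠ ⊤ := by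
    intro h
    have hs : Function.Surjective (powMonoidHom p : H →* H) := MonoidHom.range_eq_top.1 h
    have hi : Function.Injective (powMonoidHom p : H →* H) := Finite.injective_iff_surjective.2 hs
    obtain ⟨x, hx⟩ := exists_prime_orderOf_dvd_card' p hc
    have : x = 1 := hi (by simp [← hx, pow_orderOf_eq_one])
    rw [this, orderOf_one] at hx
    exact hp.one_lt.ne hx
  obtain ⟨h0, hh0⟩ : ∃ h0, h0 ∉ R := by
    by_contra hcon
    push Not at hcon
    exact hR (eq_top_iff.2 fun x _ => hcon x)
  have hexp : Monoid.exponent (H ⧸ R) ∣ p := by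
    apply Monoid.exponent_dvd_of_forall_pow_eq_one
    intro x
    induction x using QuotientGroup.induction_on with
    | H z =>
      rw [← QuotientGroup.mk_pow, QuotientGroup.eq_one_iff]
      exact ⟨z, rfl⟩
  have : HasEnoughRootsOfUnity F p := ⟨⟨ω, hω⟩, inferInstance⟩
  have := HasEnoughRootsOfUnity.of_dvd F hexp
  obtain ⟨φ, hφ⟩ := CommGroup.exists_apply_ne_one_of_hasEnoughRootsOfUnity (H ⧸ R) F
    (a := QuotientGroup.mk h0) (by rwa [Ne, QuotientGroup.eq_one_iff])
  refine ⟨φ.comp (QuotientGroup.mk' R), ⟨h0, hφ⟩, fun h => ?_⟩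
  rw [← map_pow]
  have : (QuotientGroup.mk' R) (h ^ p) = 1 := by
    rw [QuotientGroup.mk'_apply, QuotientGroup.eq_one_iff]; exact ⟨h, rfl⟩
  rw [MonoidHom.comp_apply, this, map_one]

theorem char_exists (H F : Type*) [Group H] [Finite H] [Field F] (p : ℕ) (hp : p.Prime)
    (hcomm : ∀ a b : H, a * b = b * a)
    (ω : F) (hω : IsPrimitiveRoot ω p) (hc : p ∣ Nat.card H) :
    ∃ φ : H →* Fˣ, (∃ h, φ h ≠ 1) ∧ ∀ h, φ h ^ p = 1 := by
  let inst : CommGroup H := { (inferInstance : Group H) with mul_comm := hcomm }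
  exact char_exists_comm H F p hp ω hω hc

theorem cocycle_ext {G R : Type*} [Group G] [CommRing R] (hcomm : ∀ σ τ : G, σ * τ = τ * σ)
    (χ : G →* Rˣ) (g : G) (hg : ∀ σ, ∃ i : ℕ, χ σ = χ g ^ i) (w : G → R)
    (hw : ∀ h h', χ h = 1 → χ h' = 1 → w (h * h') = w h + w h')
    (hfix : ∀ σ h, χ h = 1 → (χ σ : R) * w h = w h) (a : R)
    (ha : (∑ i ∈ Finset.range (orderOf (χ g)), (χ g : R) ^ i) * a = w (g ^ orderOf (χ g))) :
    ∃ C : G → R, (∀ σ τ, C (σ * τ) = C σ + χ σ * C τ) ∧ ∀ h, χ h = 1 → C h = w h := by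
  set d := orderOf (χ g) with hd
  let N : ℕ → R := fun i => ∑ j ∈ Finset.range i, (χ g : R) ^ j
  have hN0 : N 0 = 0 := by simp [N]
  have hNadd : ∀ i j, N (i + j) = N i + (χ g : R) ^ i * N j := by
    intro i j
    simp only [N]
    rw [Finset.sum_range_add, Finset.mul_sum]
    simp only [pow_add]
  have hw1 : w 1 = 0 := by
    have := hw 1 1 (map_one χ) (map_one χ)
    rw [mul_one] at this
    simpa using this
  have hgd : χ (g ^ d) = 1 := by rw [map_pow, pow_orderOf_eq_one]
  have hdR : (χ g : R) ^ d = 1 := by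
    rw [← Units.val_pow_eq_pow_val, hd, pow_orderOf_eq_one, Units.val_one]
  have hNd : ∀ e, N (d * e) * a = w (g ^ (d * e)) := by
    intro e
    induction e with
    | zero => simp [hN0, hw1]
    | succ e ih =>
      rw [Nat.mul_succ, hNadd, pow_mul, hdR, one_pow, one_mul, add_mul, ih, pow_add, hw _ _ (by rw [pow_mul, map_pow, hgd, one_pow]) hgd, ← ha]
  have hrep : ∀ σ, ∃ ih : ℕ × G, χ ih.2 = 1 ∧ σ = g ^ ih.1 * ih.2 := by
    intro σ
    obtain ⟨i, hi⟩ := hg σ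
    refine ⟨(i, (g ^ i)⁻¹ * σ), ?_, by simp⟩
    simp [hi]
  have hwd' : ∀ i l h h', χ h = 1 → χ h' = 1 → g ^ i * h = g ^ (i + l) * h' →
      N i * a + w h = N (i + l) * a + w h' := by
    intro i l h h' hh hh' heq
    rw [pow_add, mul_assoc] at heq
    have heq := mul_left_cancel heq
    have hl : χ (g ^ l) = 1 := by
      have := congrArg χ heq
      rwa [map_mul, hh, hh', mul_one, eq_comm] at this
    have hdl : d ∣ l := orderOf_dvd_of_pow_eq_one (by rwa [map_pow] at hl)
    obtain ⟨e, rfl⟩ := hdl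
    rw [heq, hw _ _ hl hh', hNadd, add_mul, mul_assoc, hNd]
    have := hfix (g ^ i) _ hl
    rw [map_pow, Units.val_pow_eq_pow_val] at this
    rw [this]; ring
  have hwd : ∀ i j h h', χ h = 1 → χ h' = 1 → g ^ i * h = g ^ j * h' →
      N i * a + w h = N j * a + w h' := by
    intro i j h h' hh hh' heq
    rcases le_total i j with hij | hij
    · obtain ⟨l, rfl⟩ := Nat.exists_eq_add_of_le hij
      exact hwd' _ _ _ _ hh hh' heq
    · obtain ⟨l, rfl⟩ := Nat.exists_eq_add_of_le hij
      exact (hwd' _ _ _ _ hh' hh heq.symm).symm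
  choose r hr1 hr2 using hrep
  have hC : ∀ i h, χ h = 1 → N (r (g ^ i * h)).1 * a + w (r (g ^ i * h)).2 = N i * a + w h :=
    fun i h hh => hwd _ _ _ _ (hr1 _) hh (hr2 _).symm
  refine ⟨fun σ => N (r σ).1 * a + w (r σ).2, ?_, ?_⟩
  · intro σ τ
    have h1 : σ * τ = g ^ ((r σ).1 + (r τ).1) * ((r σ).2 * (r τ).2) := by
      conv_lhs => rw [hr2 σ, hr2 τ]
      rw [pow_add, mul_assoc, mul_assoc, ← mul_assoc (r σ).2, hcomm (r σ).2 (g ^ _), mul_assoc]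
    have h2 := hC ((r σ).1 + (r τ).1) ((r σ).2 * (r τ).2) (by rw [map_mul, hr1, hr1, one_mul])
    rw [← h1] at h2
    beta_reduce
    rw [h2, hw _ _ (hr1 _) (hr1 _), hNadd, mul_add, hfix _ _ (hr1 τ)]
    have h3 : (χ σ : R) = (χ g : R) ^ (r σ).1 := by
      conv_lhs => rw [hr2 σ]
      rw [map_mul, hr1, mul_one, map_pow, Units.val_pow_eq_pow_val]
    rw [h3]; ring
  · intro h hh
    have := hC 0 h hh
    simpa [hN0] using this


section main
variable {k K : Type*} [Field k] [Field K] [Algebra k K]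

theorem setup_E (q : ℕ) [NeZero q] (ζ : K) (hζ : IsPrimitiveRoot ζ q) :
    ∃ E : AddChar (ZMod q) K, Function.Injective E ∧
      (∀ (σ : K ≃ₐ[k] K) a, σ (E a) = E ((hζ.autToPow k σ : ZMod q) * a)) ∧
      (∀ ξ : K, ξ ^ q = 1 → ∃ a, E a = ξ) ∧ (∀ a, E a ^ q = 1) ∧ (∀ i : ℕ, E i = ζ ^ i) := by
  refine ⟨AddChar.zmodChar q hζ.pow_eq_one, ?_, ?_, ?_, ?_, ?_⟩
  · intro a b hab
    rw [AddChar.zmodChar_apply, AddChar.zmodChar_apply] at hab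
    exact ZMod.val_injective q (hζ.pow_inj (ZMod.val_lt a) (ZMod.val_lt b) hab)
  · intro σ a
    have h1 : ((hζ.autToPow k σ : ZMod q) * a) =
        (((hζ.autToPow k σ : ZMod q).val * a.val : ℕ) : ZMod q) := by simp
    rw [h1, AddChar.zmodChar_apply', AddChar.zmodChar_apply, map_pow, ← hζ.autToPow_spec k σ, pow_mul]
  · intro ξ hξ
    obtain ⟨i, -, hi⟩ := hζ.eq_pow_of_pow_eq_one hξ
    exact ⟨i, by rw [AddChar.zmodChar_apply', hi]⟩
  · intro a
    rw [AddChar.zmodChar_apply, ← pow_mul, mul_comm, pow_mul, hζ.pow_eq_one, one_pow]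
  · intro i
    rw [AddChar.zmodChar_apply']

theorem mem_fix (q : ℕ) [NeZero q] (ζ : K) (hζ : IsPrimitiveRoot ζ q) (h : K ≃ₐ[k] K) :
    h ∈ (IntermediateField.adjoin k {x : K | x ^ q = 1}).fixingSubgroup ↔
      hζ.autToPow k h = 1 := by
  obtain ⟨E, hEi, hEσ, hEs, hEq, hEn⟩ := setup_E (k := k) q ζ hζ
  constructor
  · intro hh
    rw [IntermediateField.mem_fixingSubgroup_iff] at hh
    have h1 := hh ζ (IntermediateField.subset_adjoin _ _ hζ.pow_eq_one)
    have h2 : E 1 = ζ := by simpa using hEn 1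
    rw [← h2, hEσ] at h1
    have := hEi h1
    rw [mul_one] at this
    exact Units.ext this
  · intro hh
    have hle : IntermediateField.adjoin k {x : K | x ^ q = 1} ≤
        IntermediateField.fixedField (Subgroup.zpowers h) := by
      rw [IntermediateField.adjoin_le_iff]
      intro ξ hξ
      obtain ⟨a, rfl⟩ := hEs ξ hξ
      rw [SetLike.mem_coe, IntermediateField.mem_fixedField_iff]
      rintro _ ⟨i, rfl⟩
      rw [hEσ, map_zpow, hh, one_zpow, Units.val_one, one_mul]
    rw [IntermediateField.le_iff_le] at hle
    exact hle (Subgroup.mem_zpowers h)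

theorem exists_gen [FiniteDimensional k K] (p n : ℕ) (hp : p.Prime) [NeZero (p ^ n)] (ζ : K) (hζ : IsPrimitiveRoot ζ (p ^ n))
    (hns : p = 2 → 2 ≤ n → ∀ σ : K ≃ₐ[k] K, σ ζ ≠ ζ⁻¹) :
    ∃ g : K ≃ₐ[k] K, (∀ σ, ∃ i : ℕ, hζ.autToPow k σ = hζ.autToPow k g ^ i) ∧
      (p = 2 → 2 ≤ n → hζ.autToPow k g ≠ -1) := by
  obtain ⟨E, hEi, hEσ, hEs, hEq, hEn⟩ := setup_E (k := k) _ ζ hζ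
  have hm1 : p = 2 → 2 ≤ n → ∀ σ : K ≃ₐ[k] K, hζ.autToPow k σ ≠ -1 := by
    intro h2 hn σ hσ
    apply hns h2 hn σ
    have h2 : E 1 = ζ := by simpa using hEn 1
    rw [← h2, hEσ, hσ, ← AddChar.map_neg_eq_inv]
    simp
  have hcyc := aux_cyc p n hp (hζ.autToPow k).range (by
    rintro h2 hn ⟨σ, hσ⟩
    exact hm1 h2 hn σ hσ)
  obtain ⟨⟨_, g, rfl⟩, hg⟩ := hcyc.exists_generator
  refine ⟨g, fun σ => ?_, fun h2 hn => hm1 h2 hn g⟩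
  have h1 := hg ⟨hζ.autToPow k σ, σ, rfl⟩
  rw [← mem_powers_iff_mem_zpowers] at h1
  obtain ⟨i, hi⟩ := h1
  exact ⟨i, by simpa using (congrArg Subtype.val hi).symm⟩

theorem one_le_val (q : ℕ) (hq : 1 < q) (u : (ZMod q)ˣ) : 1 ≤ (u : ZMod q).val := by
  have := Fact.mk hq
  have : NeZero q := ⟨by omega⟩
  rw [Nat.one_le_iff_ne_zero, Ne, ZMod.val_eq_zero]
  exact u.ne_zero

/-- The p-th roots of unity are in `k` iff every automorphism acts by exponent `1` mod `p`. -/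
theorem root_iff [FiniteDimensional k K] [IsGalois k K] (p n : ℕ) (hp : p.Prime) (hn : 1 ≤ n)
    [NeZero (p ^ n)] (ζ : K) (hζ : IsPrimitiveRoot ζ (p ^ n)) :
    (∃ ω : k, IsPrimitiveRoot ω p) ↔
      ∀ σ : K ≃ₐ[k] K, p ∣ (hζ.autToPow k σ : ZMod (p ^ n)).val - 1 := by
  obtain ⟨m, rfl⟩ : ∃ m, n = m + 1 := ⟨n - 1, by omega⟩
  have hq : 1 < p ^ (m + 1) := Nat.one_lt_pow (by omega) hp.one_lt
  have hω : IsPrimitiveRoot (ζ ^ p ^ m) p := hζ.pow (by omega) (by rw [pow_succ])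
  have : NeZero p := ⟨hp.ne_zero⟩
  have key : ∀ σ : K ≃ₐ[k] K, σ (ζ ^ p ^ m) = ζ ^ p ^ m ↔
      p ∣ (hζ.autToPow k σ : ZMod (p ^ (m + 1))).val - 1 := by
    intro σ
    have h1 := one_le_val _ hq (hζ.autToPow k σ)
    rw [map_pow, ← hζ.autToPow_spec k σ, ← pow_mul, mul_comm, pow_mul]
    set v := (hζ.autToPow k σ : ZMod (p ^ (m + 1))).val with hv
    clear_value v
    have hω0 : ζ ^ p ^ m ≠ 0 := hω.ne_zero hp.ne_zero
    rw [← hω.pow_eq_one_iff_dvd]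
    constructor
    · intro h
      have : (ζ ^ p ^ m) ^ (v - 1) * ζ ^ p ^ m = 1 * ζ ^ p ^ m := by
        rw [← pow_succ, Nat.sub_add_cancel h1, h, one_mul]
      exact mul_right_cancel₀ hω0 this
    · intro h
      rw [← Nat.sub_add_cancel h1, pow_succ, h, one_mul]
  constructor
  · rintro ⟨ω, hωk⟩ σ
    rw [← key]
    have h2 : IsPrimitiveRoot (algebraMap k K ω) p := hωk.map_of_injective (algebraMap k K).injective
    obtain ⟨i, -, hi⟩ := h2.eq_pow_of_pow_eq_one hω.pow_eq_one
    rw [← hi, map_pow, σ.commutes]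
  · intro h
    obtain ⟨ω, hω'⟩ := (IsGalois.mem_range_algebraMap_iff_fixed (F := k) (ζ ^ p ^ m)).2
      (fun σ => (key σ).2 (h σ))
    refine ⟨ω, ?_⟩
    rw [← hω'] at hω
    exact hω.of_map_of_injective (algebraMap k K).injective

theorem part_fwd [FiniteDimensional k K] [IsGalois k K]
    (habelian : ∀ σ τ : K ≃ₐ[k] K, σ * τ = τ * σ)
    (p n : ℕ) (hp : p.Prime) (hn : 1 ≤ n) (ζ : K) (hζ : IsPrimitiveRoot ζ (p ^ n))
    (hns : p = 2 → 2 ≤ n → ∀ σ : K ≃ₐ[k] K, σ ζ ≠ ζ⁻¹)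
    (x : kˣ) (y : K) (hy : y ^ p ^ n = algebraMap k K (x : k))
    (hx : ¬∃ z : k, z ^ p ^ n = (x : k)) :
    (∃ ω : k, IsPrimitiveRoot ω p) ∧
      p ∣ Module.finrank (IntermediateField.adjoin k {x : K | x ^ p ^ n = 1}) K := by
  have hq0 : NeZero (p ^ n) := ⟨pow_ne_zero _ hp.ne_zero⟩
  have hq : 1 < p ^ n := Nat.one_lt_pow (by omega) hp.one_lt
  obtain ⟨E, hEi, hEσ, hEs, hEq, hEn⟩ := setup_E (k := k) _ ζ hζ
  set χ := hζ.autToPow k with hχ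
  have hy0 : y ≠ 0 := by
    rintro rfl
    rw [zero_pow hq0.ne, eq_comm, map_eq_zero] at hy
    exact x.ne_zero hy
  have hcoc : ∀ σ : K ≃ₐ[k] K, ∃ a, σ y = E a * y := by
    intro σ
    obtain ⟨a, ha⟩ := hEs (σ y / y) (by
      rw [div_pow, ← map_pow, hy, σ.commutes, div_self]
      simp)
    exact ⟨a, by rw [ha]; field_simp⟩
  have hE0 : ∀ a, E a * y = y → a = 0 := by
    intro a ha
    apply hEi
    rw [AddChar.map_zero_eq_one]
    exact mul_right_cancel₀ hy0 (by rw [ha, one_mul])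
  have hnot : ¬ ∃ b, ∀ σ : K ≃ₐ[k] K, σ (E b * y) = E b * y := by
    rintro ⟨b, hb⟩
    obtain ⟨z, hz⟩ := (IsGalois.mem_range_algebraMap_iff_fixed (F := k) (E b * y)).2 hb
    apply hx
    refine ⟨z, (algebraMap k K).injective ?_⟩
    rw [map_pow, hz, mul_pow, hEq, one_mul, hy]
  have hroot : ∀ σ : K ≃ₐ[k] K, p ∣ (χ σ : ZMod (p ^ n)).val - 1 := by
    by_contra hcon
    push Not at hcon
    obtain ⟨σ, hσ⟩ := hcon
    have h1 := one_le_val _ hq (χ σ)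
    have hu : IsUnit ((χ σ : ZMod (p ^ n)) - 1) := by
      have h2 : ((χ σ : ZMod (p ^ n)) - 1) = (((χ σ : ZMod (p ^ n)).val - 1 : ℕ) : ZMod (p ^ n)) := by
        rw [Nat.cast_sub h1]; simp
      rw [h2, ZMod.isUnit_iff_coprime]
      exact Nat.Coprime.pow_right _ ((Nat.Prime.coprime_iff_not_dvd hp).2 hσ).symm
    obtain ⟨v, hv⟩ := hu
    obtain ⟨a, ha⟩ := hcoc σ
    have hb1 : ((χ σ : ZMod (p ^ n)) - 1) * (-(↑v⁻¹ * a)) = -a := by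
      rw [← hv]; simp
    set b := -(↑v⁻¹ * a) with hb
    have hfix : σ (E b * y) = E b * y := by
      rw [map_mul, hEσ, ha, ← mul_assoc, ← AddChar.map_add_eq_mul]
      congr 2
      linear_combination hb1
    apply hnot
    refine ⟨b, fun τ => ?_⟩
    obtain ⟨e, he⟩ := hcoc τ
    have hτ : τ (E b * y) = E (χ τ * b + e - b) * (E b * y) := by
      rw [map_mul, hEσ, he, ← mul_assoc, ← mul_assoc, ← AddChar.map_add_eq_mul,
        ← AddChar.map_add_eq_mul]
      congr 2
      ring
    set c := (χ τ : ZMod (p ^ n)) * b + e - b with hc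
    have h3 : σ (τ (E b * y)) = τ (σ (E b * y)) := by
      have := congrArg (fun f : K ≃ₐ[k] K => f (E b * y)) (habelian σ τ)
      simpa only [AlgEquiv.mul_apply] using this
    rw [hfix, hτ, map_mul, hfix, hEσ] at h3
    have hne : E b * y ≠ 0 := mul_ne_zero (by
      intro h0
      have := hEq b
      rw [h0, zero_pow hq0.ne] at this
      exact zero_ne_one this) hy0
    have h4 := hEi (mul_right_cancel₀ hne h3)
    have h5 : c = 0 := by
      have h6 : (v : ZMod (p ^ n)) * c = 0 := by rw [hv]; linear_combination h4
      simpa using h6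
    rw [hτ, h5, AddChar.map_zero_eq_one, one_mul]
  refine ⟨(root_iff p n hp hn ζ hζ).2 hroot, ?_⟩
  rw [← IsGalois.card_fixingSubgroup_eq_finrank]
  set H := (IntermediateField.adjoin k {x : K | x ^ p ^ n = 1}).fixingSubgroup with hH
  have hHmem : ∀ h, h ∈ H ↔ χ h = 1 := fun h => mem_fix _ ζ hζ h
  by_contra hcard
  have hpow : ∀ (σ : K ≃ₐ[k] K) a, σ y = E a * y → ∀ i : ℕ,
      (σ ^ i) y = E ((∑ j ∈ Finset.range i, (χ σ : ZMod (p ^ n)) ^ j) * a) * y := by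
    intro σ a ha i
    induction i with
    | zero => simp
    | succ i ih =>
      rw [pow_succ', AlgEquiv.mul_apply, ih, map_mul, hEσ, ha, ← mul_assoc,
        ← AddChar.map_add_eq_mul, geom_sum_succ]
      congr 2
      ring
  have hHy : ∀ h ∈ H, h y = y := by
    intro h hh
    obtain ⟨a, ha⟩ := hcoc h
    have h1 := hpow h a ha (Nat.card H)
    have h2 : h ^ Nat.card H = 1 := by
      have := pow_card_eq_one' (x := (⟨h, hh⟩ : H))
      exact congrArg Subtype.val this
    rw [h2, AlgEquiv.one_apply, (hHmem h).1 hh] at h1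
    have h3 := hE0 _ h1.symm
    simp only [Units.val_one, one_pow, Finset.sum_const, Finset.card_range, nsmul_eq_mul, mul_one] at h3
    have hu : IsUnit ((Nat.card H : ℕ) : ZMod (p ^ n)) := by
      rw [ZMod.isUnit_iff_coprime]
      exact Nat.Coprime.pow_right _ ((Nat.Prime.coprime_iff_not_dvd hp).2 hcard).symm
    have h4 : a = 0 := hu.mul_right_eq_zero.1 h3
    rw [ha, h4, AddChar.map_zero_eq_one, one_mul]
  obtain ⟨g, hg, hgm⟩ := exists_gen (k := k) p n hp ζ hζ hns
  obtain ⟨-, hA⟩ := aux_arith p n hp hn (χ g) (hroot g) hgm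
  obtain ⟨a, ha⟩ := hcoc g
  have hgd : g ^ orderOf (χ g) ∈ H := by rw [hHmem, map_pow, pow_orderOf_eq_one]
  have h1 := hpow g a ha (orderOf (χ g))
  rw [hHy _ hgd] at h1
  have h2 := hE0 _ h1.symm
  obtain ⟨b, hb⟩ := hA (-a) (by rw [mul_neg, h2, neg_zero])
  have hfix : g (E b * y) = E b * y := by
    rw [map_mul, hEσ, ha, ← mul_assoc, ← AddChar.map_add_eq_mul]
    congr 2
    linear_combination hb
  have hfixi : ∀ i : ℕ, (g ^ i) (E b * y) = E b * y := by
    intro i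
    induction i with
    | zero => simp
    | succ i ih => rw [pow_succ, AlgEquiv.mul_apply, hfix, ih]
  apply hnot
  refine ⟨b, fun σ => ?_⟩
  obtain ⟨i, hi⟩ := hg σ
  have hh : (g ^ i)⁻¹ * σ ∈ H := by
    rw [hHmem, map_mul, map_inv, map_pow, hχ, hi, inv_mul_cancel]
  have h3 : ((g ^ i)⁻¹ * σ) (E b * y) = E b * y := by
    rw [map_mul, hHy _ hh, hEσ, (hHmem _).1 hh, Units.val_one, one_mul]
  have h4 : σ = g ^ i * ((g ^ i)⁻¹ * σ) := by group
  rw [h4, AlgEquiv.mul_apply, h3, hfixi]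

theorem part_bwd [FiniteDimensional k K] [IsGalois k K]
    (habelian : ∀ σ τ : K ≃ₐ[k] K, σ * τ = τ * σ)
    (p n : ℕ) (hp : p.Prime) (hn : 1 ≤ n) (ζ : K) (hζ : IsPrimitiveRoot ζ (p ^ n))
    (hns : p = 2 → 2 ≤ n → ∀ σ : K ≃ₐ[k] K, σ ζ ≠ ζ⁻¹)
    (ω : k) (hω : IsPrimitiveRoot ω p)
    (hdvd : p ∣ Module.finrank (IntermediateField.adjoin k {x : K | x ^ p ^ n = 1}) K) :
    ∃ x : kˣ, (∃ y : K, y ^ p ^ n = algebraMap k K (x : k)) ∧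
          ¬∃ z : k, z ^ p ^ n = (x : k) := by
  have hq0 : NeZero (p ^ n) := ⟨pow_ne_zero _ hp.ne_zero⟩
  have hq : 1 < p ^ n := Nat.one_lt_pow (by omega) hp.one_lt
  obtain ⟨E, hEi, hEσ, hEs, hEq, hEn⟩ := setup_E (k := k) _ ζ hζ
  have hroot := (root_iff p n hp hn ζ hζ).1 ⟨ω, hω⟩
  set χ := hζ.autToPow k with hχ
  have hE0 : ∀ b, E b ≠ 0 := by
    intro b h0
    have := hEq b
    rw [h0, zero_pow hq0.ne] at this
    exact zero_ne_one this
  rw [← IsGalois.card_fixingSubgroup_eq_finrank] at hdvd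
  set H := (IntermediateField.adjoin k {x : K | x ^ p ^ n = 1}).fixingSubgroup with hH
  have hHmem : ∀ h, h ∈ H ↔ χ h = 1 := fun h => mem_fix _ ζ hζ h
  obtain ⟨φ, ⟨⟨h0, hh0⟩, hφ0⟩, hφp⟩ := char_exists H k p hp
    (fun a b => Subtype.ext (habelian a b)) ω hω hdvd
  obtain ⟨m, rfl⟩ : ∃ m, n = m + 1 := ⟨n - 1, by omega⟩
  have hwex : ∀ h : K ≃ₐ[k] K, ∃ w, ∀ hh : h ∈ H, E w = algebraMap k K (φ ⟨h, hh⟩ : k) := by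
    intro h
    by_cases hh : h ∈ H
    · obtain ⟨w, hw⟩ := hEs (algebraMap k K (φ ⟨h, hh⟩ : k)) (by
        have h1 : ((φ ⟨h, hh⟩ : kˣ) : k) ^ p = 1 := by
          rw [← Units.val_pow_eq_pow_val, hφp, Units.val_one]
        rw [← map_pow, pow_succ', pow_mul, h1, one_pow, map_one])
      exact ⟨w, fun _ => hw⟩
    · exact ⟨0, fun h => absurd h hh⟩
  choose w hw using hwex
  have hwp : ∀ h, h ∈ H → (p : ZMod (p ^ (m + 1))) * w h = 0 := by
    intro h hh
    apply hEi
    rw [← nsmul_eq_mul, AddChar.map_nsmul_eq_pow, hw h hh, ← map_pow, ← Units.val_pow_eq_pow_val, hφp,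
      Units.val_one, map_one, AddChar.map_zero_eq_one]
  obtain ⟨g, hg, hgm⟩ := exists_gen (k := k) p (m + 1) hp ζ hζ hns
  obtain ⟨hN, -⟩ := aux_arith p (m + 1) hp hn (χ g) (hroot g) hgm
  -- solve for `a`
  have hsolve : ∀ N c : ZMod (p ^ (m + 1)), N ≠ 0 → (p : ZMod (p ^ (m + 1))) * c = 0 →
      ∃ a, N * a = c := by
    intro N c hN hc
    have h1 : ((p * c.val : ℕ) : ZMod (p ^ (m + 1))) = 0 := by simpa using hc
    rw [ZMod.natCast_eq_zero_iff] at h1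
    have h1' : p * p ^ m ∣ p * c.val := by
      rw [← pow_succ']
      exact h1
    obtain ⟨c', hc'⟩ := Nat.dvd_of_mul_dvd_mul_left hp.pos h1'
    have hNv : N.val ≠ 0 := by rwa [Ne, ZMod.val_eq_zero]
    have hgcd := Nat.gcd_dvd_right N.val (p ^ (m + 1))
    obtain ⟨i, hi, hgi⟩ := (Nat.dvd_prime_pow hp).1 hgcd
    have him : i ≤ m := by
      by_contra hcon
      have : i = m + 1 := by omega
      rw [this] at hgi
      have h2 := Nat.gcd_dvd_left N.val (p ^ (m + 1))
      rw [hgi] at h2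
      exact absurd (Nat.le_of_dvd (by omega) h2) (not_le.2 (ZMod.val_lt N))
    have hbez := Nat.gcd_eq_gcd_ab N.val (p ^ (m + 1))
    have hbez' := congrArg (Int.cast (R := ZMod (p ^ (m + 1)))) hbez
    rw [hgi] at hbez'
    have hself : (p : ZMod (p ^ (m + 1))) ^ (m + 1) = 0 := by
      rw [← Nat.cast_pow, ZMod.natCast_self]
    push_cast at hbez'
    rw [hself, zero_mul, add_zero, ZMod.natCast_zmod_val] at hbez'
    have hcc : c = (p : ZMod (p ^ (m + 1))) ^ i * ((p : ZMod (p ^ (m + 1))) ^ (m - i) * c') := by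
      rw [← mul_assoc, ← pow_add, Nat.add_sub_of_le him]
      have := congrArg (Nat.cast (R := ZMod (p ^ (m + 1)))) hc'
      rw [ZMod.natCast_zmod_val] at this
      rw [this]; push_cast; ring
    rw [hcc, hbez', mul_assoc]
    exact ⟨_, rfl⟩
  have hgd : g ^ orderOf (χ g) ∈ H := by rw [hHmem, map_pow, pow_orderOf_eq_one]
  obtain ⟨a, ha⟩ := hsolve _ _ hN (hwp _ hgd)
  obtain ⟨C, hC1, hC2⟩ := cocycle_ext habelian χ g hg w
    (by
      intro h h' hh hh'
      rw [← hHmem] at hh hh'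
      apply hEi
      rw [AddChar.map_add_eq_mul, hw h hh, hw h' hh', hw _ (mul_mem hh hh'), ← map_mul,
        ← Units.val_mul, ← map_mul]
      rfl)
    (by
      intro σ h hh
      rw [← hHmem] at hh
      apply hEi
      rw [← hEσ, hw h hh, σ.commutes]) a ha
  let f : (K ≃ₐ[k] K) → Kˣ := fun σ => Units.mk0 (E (C σ)) (hE0 _)
  obtain ⟨y, hy⟩ := groupCohomology.isMulCoboundary₁_of_isMulCocycle₁_of_aut_to_units f (by
    intro σ τ
    ext
    change E (C (σ * τ)) = σ (E (C τ)) * E (C σ)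
    rw [hC1, hEσ, ← AddChar.map_add_eq_mul, add_comm (C σ)])
  have hy' : ∀ σ : K ≃ₐ[k] K, σ (y : K) = E (C σ) * y := by
    intro σ
    have h1 := hy σ
    rw [div_eq_iff_eq_mul] at h1
    exact congrArg Units.val h1
  obtain ⟨x, hx⟩ := (IsGalois.mem_range_algebraMap_iff_fixed (F := k) ((y : K) ^ p ^ (m + 1))).2
    (fun σ => by
      change σ _ = _
      rw [map_pow, hy', mul_pow, hEq, one_mul])
  have hx0 : x ≠ 0 := by
    rintro rfl
    rw [map_zero] at hx
    exact pow_ne_zero _ y.ne_zero hx.symm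
  refine ⟨Units.mk0 x hx0, ⟨y, hx.symm⟩, ?_⟩
  rintro ⟨z, hz⟩
  rw [Units.val_mk0] at hz
  have hz0 : algebraMap k K z ≠ 0 := by
    intro h
    rw [map_eq_zero] at h
    rw [h, zero_pow hq0.ne] at hz
    exact hx0 hz.symm
  obtain ⟨b, hb⟩ := hEs (y / algebraMap k K z) (by
    rw [div_pow, ← hx, ← map_pow, hz, div_self]
    simpa using hx0)
  have hyb : (y : K) = E b * algebraMap k K z := by rw [hb]; field_simp
  have hfix : h0 (y : K) = y := by
    rw [hyb, map_mul, hEσ, (hHmem _).1 hh0, Units.val_one, one_mul, AlgEquiv.commutes]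
  have h1 := hy' h0
  rw [hfix, hC2 h0 ((hHmem _).1 hh0), hw h0 hh0] at h1
  apply hφ0
  have h2 : algebraMap k K (φ ⟨h0, hh0⟩ : k) = 1 :=
    mul_right_cancel₀ y.ne_zero (by rw [← h1, one_mul])
  rw [map_eq_one_iff _ (algebraMap k K).injective] at h2
  exact Units.ext h2

end main

/-- Non-triviality criterion for `H¹(K/k, μ_{pⁿ})` for a finite abelian Galois extension `K/k`
with `μ_{pⁿ} ⊆ K`: (a) outside the special case, some element of `kˣ` is a `pⁿ`-th power in `K`
but not in `k` iff `μ_p ⊆ k` and `p ∣ [K : k(μ_{pⁿ})]`; (b) in the special case (so `p = 2`)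
such an element always exists. -/
theorem exists_pow_nontrivial_iff (k K : Type*) [Field k] [CharZero k] [Field K]
    [Algebra k K] [FiniteDimensional k K] [IsGalois k K]
    (habelian : ∀ σ τ : K ≃ₐ[k] K, σ * τ = τ * σ)
    (p n : ℕ) (hp : p.Prime) (hn : 1 ≤ n)
    (hζ : ∃ ζ : K, IsPrimitiveRoot ζ (p ^ n)) :
    (¬IsSpecialCase k p n →
      ((∃ x : kˣ, (∃ y : K, y ^ p ^ n = algebraMap k K (x : k)) ∧
          ¬∃ z : k, z ^ p ^ n = (x : k)) ↔
        ((∃ ζ : k, IsPrimitiveRoot ζ p) ∧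
          p ∣ Module.finrank (IntermediateField.adjoin k {x : K | x ^ p ^ n = 1}) K))) ∧
    (p = 2 → IsSpecialCase k 2 n →
      ∃ x : kˣ, (∃ y : K, y ^ 2 ^ n = algebraMap k K (x : k)) ∧
        ¬∃ z : k, z ^ 2 ^ n = (x : k)) := by
  obtain ⟨ζ, hζ⟩ := hζ
  refine ⟨fun hns => ?_, fun h2 hs => ?_⟩
  · have hns' : p = 2 → 2 ≤ n → ∀ σ : K ≃ₐ[k] K, σ ζ ≠ ζ⁻¹ := by
      rintro rfl hn2 σ hσ
      exact hns ((special_iff k K n hn2 ζ hζ).2 ⟨σ, hσ⟩)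
    constructor
    · rintro ⟨x, ⟨y, hy⟩, hx⟩
      exact part_fwd habelian p n hp hn ζ hζ hns' x y hy hx
    · rintro ⟨⟨ω, hω⟩, hdvd⟩
      exact part_bwd habelian p n hp hn ζ hζ hns' ω hω hdvd
  · subst h2
    obtain ⟨σ, hσ⟩ := (special_iff k K n hs.2.1 ζ hζ).1 hs
    exact part_b k K n hs.2.1 ζ hζ σ hσ
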